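/- Let r ≥ 2 and consider ℚ^r. Let C = {ξ : ξ₁ ≥ ⋯ ≥ ξ_{r−1} ≥ |ξ_r|} (the dominant Weyl chamber of type D_r), Φ = {ξ : Σ|ξ_i| ≤ 1}, and let D be the rational convex hull of 0, ε₁, (ε₁+ε₂)/2, …, (ε₁+⋯+ε_r)/r, and (ε₁+⋯+ε_{r−1}−ε_r)/r. Then Φ ∩ C ⊆ D. -/

import Mathlib

theorem aux_tail (f : ℕ → ℚ) (j n : ℕ) :
    ∑ i ∈ Finset.range n, (if j ≤ i then f i - f (i + 1) else 0) = if j ≤ n then f j - f n else 0 := by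
  induction n with
  | zero =>
    by_cases h : j ≤ 0
    · obtain rfl : j = 0 := by omega
      simp
    · simp [h]
  | succ n ih =>
    rw [Finset.sum_range_succ, ih]
    rcases lt_trichotomy j (n + 1) with h | h | h
    · have h1 : j ≤ n := by omega
      have h2 : j ≤ n + 1 := by omega
      simp [h1, h2]
    · subst h
      simp
    · have h1 : ¬ j ≤ n := by omega
      have h2 : ¬ j ≤ n + 1 := by omega
      simp [h1, h2]

theorem aux_abel (f : ℕ → ℚ) (n : ℕ) :
    ∑ i ∈ Finset.range n, ((i : ℚ) + 1) * (f i - f (i + 1))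
      = ∑ i ∈ Finset.range n, f i - n * f n := by
  induction n with
  | zero => simp
  | succ n ih =>
    rw [Finset.sum_range_succ, Finset.sum_range_succ, ih]
    push_cast
    ring

theorem aux_convex {r : ℕ} {S : Set (Fin r → ℚ)} (hS : Convex ℚ S) (h0 : 0 ∈ S)
    (c : Fin r → ℚ) (p : Fin r → Fin r → ℚ) (hc : ∀ i, 0 ≤ c i) (h1 : ∑ i, c i ≤ 1)
    (hp : ∀ i, p i ∈ S) : ∑ i, c i • p i ∈ S := by
  have := hS.sum_mem (t := Finset.univ) (w := fun o : Option (Fin r) => o.elim (1 - ∑ i, c i) c)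
    (z := fun o : Option (Fin r) => o.elim 0 p) ?_ ?_ ?_
  · simpa [Fintype.sum_option] using this
  · rintro (_ | i) _
    · simpa using h1
    · exact hc i
  · simp [Fintype.sum_option]
  · rintro (_ | i) _
    · exact h0
    · exact hp i

/-- D_r case of the momentum-polytope lemma. If `ξ ∈ ℚ^r` satisfies
`ξ₁ ≥ ⋯ ≥ ξ_{r−1} ≥ |ξ_r|` and `Σ|ξᵢ| ≤ 1`, then `ξ` lies in the rational convex
hull of `0`, `(ε₁+⋯+εᵢ)/i` for `i = 1,…,r`, and `(ε₁+⋯+ε_{r−1}−ε_r)/r`. -/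
theorem stmt8 (r : ℕ) (hr : 2 ≤ r) (ξ : Fin r → ℚ)
    (hchain : ∀ i : Fin r, ∀ h : (i : ℕ) + 1 < r - 1, ξ ⟨(i : ℕ) + 1, by omega⟩ ≤ ξ i)
    (hlast : |ξ ⟨r - 1, by omega⟩| ≤ ξ ⟨r - 2, by omega⟩)
    (hΦ : ∑ i : Fin r, |ξ i| ≤ 1) :
    ξ ∈ convexHull ℚ (insert (0 : Fin r → ℚ)
      (insert (fun j : Fin r => if (j : ℕ) < r - 1 then (1 : ℚ) / r else -(1 : ℚ) / r)
        (Set.range (fun i : Fin r => fun j : Fin r =>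
          if j ≤ i then (1 : ℚ) / ((i : ℕ) + 1) else 0)))) := by
  have hnn : ∀ k : ℕ, ∀ hk : k ≤ r - 2, 0 ≤ ξ ⟨r - 2 - k, by omega⟩ := by
    intro k
    induction k with
    | zero => intro _; exact (abs_nonneg _).trans hlast
    | succ k ih =>
      intro hk
      have h2 := hchain ⟨r - 2 - (k + 1), by omega⟩ (by simp only; omega)
      refine (ih (by omega)).trans ?_
      have e : (⟨r - 2 - k, by omega⟩ : Fin r) = ⟨r - 2 - (k + 1) + 1, by omega⟩ := by
        rw [Fin.mk.injEq]; omega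
      rw [e]
      exact h2
  have hpos : ∀ j : Fin r, (j : ℕ) < r - 1 → 0 ≤ ξ j := by
    intro j hj
    have := hnn (r - 2 - j) (by omega)
    convert this using 2
    ext
    simp only
    omega
  set f : ℕ → ℚ := fun i => if h : i < r then |ξ ⟨i, h⟩| else 0 with hf
  have hfr : f r = 0 := by simp [hf]
  have hfj : ∀ j : Fin r, f j = |ξ j| := by intro j; simp [hf]
  have hmono : ∀ i : Fin r, f (i + 1) ≤ f i := by
    intro i
    rw [hfj]
    by_cases h1 : (i : ℕ) + 1 < r - 1
    · have e : f (i + 1) = |ξ ⟨i + 1, by omega⟩| := by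
        simp only [hf]; rw [dif_pos]
      rw [e, abs_of_nonneg (hpos _ h1), abs_of_nonneg (hpos i (by omega))]
      exact hchain i h1
    · by_cases h2 : (i : ℕ) + 1 < r
      · have e : f (i + 1) = |ξ ⟨i + 1, by omega⟩| := by
          simp only [hf]; rw [dif_pos]
        rw [e, abs_of_nonneg (hpos i (by omega))]
        have e1 : (⟨(i : ℕ) + 1, h2⟩ : Fin r) = ⟨r - 1, by omega⟩ := by
          ext; simp only; omega
        have e2 : i = ⟨r - 2, by omega⟩ := by
          ext; simp only; omega
        rw [e1]
        conv_rhs => rw [e2]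
        exact hlast
      · have e : f (i + 1) = 0 := by
          simp only [hf]; rw [dif_neg h2]
        rw [e]
        exact abs_nonneg _
  have hr0 : (r : ℚ) ≠ 0 := by
    have : r ≠ 0 := by omega
    exact_mod_cast this
  obtain ⟨s, hs, hsl⟩ : ∃ s : ℚ, (s = 1 ∨ s = -1) ∧
      s * |ξ ⟨r - 1, by omega⟩| = ξ ⟨r - 1, by omega⟩ := by
    rcases le_total 0 (ξ ⟨r - 1, by omega⟩) with h | h
    · exact ⟨1, Or.inl rfl, by rw [abs_of_nonneg h, one_mul]⟩
    · exact ⟨-1, Or.inr rfl, by rw [abs_of_nonpos h]; ring⟩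
  have key := aux_convex (convex_convexHull ℚ (insert (0 : Fin r → ℚ)
      (insert (fun j : Fin r => if (j : ℕ) < r - 1 then (1 : ℚ) / r else -(1 : ℚ) / r)
        (Set.range (fun i : Fin r => fun j : Fin r =>
          if j ≤ i then (1 : ℚ) / ((i : ℕ) + 1) else 0)))))
    (subset_convexHull ℚ _ (Set.mem_insert _ _))
    (fun i => ((i : ℕ) + 1 : ℚ) * (f i - f (i + 1)))
    (fun i j => (if (j : ℕ) < r - 1 then 1 else s) *
      (if j ≤ i then (1 : ℚ) / ((i : ℕ) + 1) else 0)) ?_ ?_ ?_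
  · convert key using 1
    ext j
    have e : ∀ i : Fin r, ((i : ℕ) + 1 : ℚ) * (f i - f (i + 1)) *
        ((if (j : ℕ) < r - 1 then 1 else s) * (if j ≤ i then (1 : ℚ) / ((i : ℕ) + 1) else 0))
        = (if (j : ℕ) < r - 1 then 1 else s) *
          (if (j : ℕ) ≤ (i : ℕ) then f i - f (i + 1) else 0) := by
      intro i
      have hi : ((i : ℕ) + 1 : ℚ) ≠ 0 := by positivity
      by_cases h : j ≤ i
      · have h' : (j : ℕ) ≤ i := h
        rw [if_pos h, if_pos h']
        field_simp
      · have h' : ¬ (j : ℕ) ≤ i := h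
        rw [if_neg h, if_neg h']
        ring
    simp only [Finset.sum_apply, Pi.smul_apply, smul_eq_mul]
    rw [Finset.sum_congr rfl (fun i _ => e i), ← Finset.mul_sum,
      Fin.sum_univ_eq_sum_range (fun i => if (j : ℕ) ≤ i then f i - f (i + 1) else 0) r,
      aux_tail, if_pos j.2.le, hfr, hfj, sub_zero]
    by_cases hj : (j : ℕ) < r - 1
    · rw [if_pos hj, abs_of_nonneg (hpos j hj), one_mul]
    · have e2 : j = ⟨r - 1, by omega⟩ := by
        ext; simp only; omega
      rw [if_neg hj, e2, hsl]
  · intro i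
    have := hmono i
    exact mul_nonneg (by positivity) (by linarith)
  · rw [Fin.sum_univ_eq_sum_range (fun i => ((i : ℕ) + 1 : ℚ) * (f i - f (i + 1))) r,
      aux_abel, hfr, ← Fin.sum_univ_eq_sum_range, Finset.sum_congr rfl (fun i _ => hfj i)]
    linarith
  · intro i
    apply subset_convexHull
    by_cases hi : s = -1 ∧ ¬ (i : ℕ) < r - 1
    · right; left
      obtain ⟨h1, h2⟩ := hi
      have e3 : ((i : ℕ) + 1 : ℚ) = r := by
        have : (i : ℕ) + 1 = r := by omega
        exact_mod_cast this
      ext j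
      have hj : j ≤ i := by
        rw [Fin.le_def]; omega
      simp only [if_pos hj, e3, h1]
      split_ifs <;> ring
    · right; right
      refine ⟨i, ?_⟩
      ext j
      simp only
      by_cases hji : j ≤ i
      · rw [if_pos hji]
        by_cases hj : (j : ℕ) < r - 1
        · rw [if_pos hj, one_mul]
        · rw [if_neg hj]
          rw [Fin.le_def] at hji
          have : s = 1 := by
            rcases hs with h | h
            · exact h
            · exact absurd ⟨h, by omega⟩ hi
          rw [this, one_mul]
      · rw [if_neg hji, mul_zero]
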